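/- arXiv:1611.07830 — 2 statements merged into one kernel-verified Lean document; each statement's English description precedes it below -/
import Mathlib

section
/- For any real structure σ on ℂl(V), the σ-product (a,b)_σ = τ_n(σ(aᵀ)b) is a nondegenerate hermitian sesquilinear form on ℂl(V). Its associated quadratic form satisfies (v,v)_σ = Q_σ(v) for all v ∈ V and (w,w)_σ = Q(w) for all w ∈ V_σ. For any w₁, …, w_r ∈ V_σ one has (w₁⋯w_r, w₁⋯w_r)_σ = Q(w₁)⋯Q(w_r). Moreover, if (e₁,…,e_n) is a pseudo-orthonormal basis of V_σ for Q, then the 2ⁿ ordered products e_I = e_{i₁}⋯e_{i_r} (I = {i₁ < … < i_r} ⊆ {1,…,n}) form a pseudo-orthonormal basis of ℂl(V) for the σ-product. -/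
noncomputable section

open TensorProduct

variable {V : Type*} [AddCommGroup V] [Module ℝ V]

/-- `ℂl(V)`: the complexified Clifford algebra of `(V, Q)` (convention `v² = Q(v)·1`). -/
abbrev CCl (Q : QuadraticForm ℝ V) := CliffordAlgebra (Q.baseChange ℂ)

/-- The canonical embedding of the real vector space `V` into `ℂl(V)`. -/
def ιr (Q : QuadraticForm ℝ V) (v : V) : CCl Q :=
  CliffordAlgebra.ι (Q.baseChange ℂ) ((1 : ℂ) ⊗ₜ[ℝ] v)

/-- `V^ℂ`: the complexification of `V`, sitting inside `ℂl(V)`. -/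
def VC (Q : QuadraticForm ℝ V) : Submodule ℂ (CCl Q) :=
  LinearMap.range (CliffordAlgebra.ι (Q.baseChange ℂ))

/-- A real structure on `ℂl(V)`: an involutive conjugate-linear algebra automorphism
stabilizing `V^ℂ`. -/
structure RealStructure (Q : QuadraticForm ℝ V) where
  toFun : CCl Q → CCl Q
  map_add' : ∀ x y, toFun (x + y) = toFun x + toFun y
  map_mul' : ∀ x y, toFun (x * y) = toFun x * toFun y
  map_smul' : ∀ (z : ℂ) (x : CCl Q), toFun (z • x) = (starRingEnd ℂ z) • toFun x
  map_one' : toFun 1 = 1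
  invol : ∀ x, toFun (toFun x) = x
  stable : ∀ x ∈ VC Q, toFun x ∈ VC Q

namespace RealStructure

theorem map_zero' {Q : QuadraticForm ℝ V} (σ : RealStructure Q) : σ.toFun 0 = 0 := by
  have h := σ.map_smul' 0 0
  simpa using h

end RealStructure

/-- The fixed points of a real structure, as a real submodule of `ℂl(V)`. -/
def fixedPoints {Q : QuadraticForm ℝ V} (σ : RealStructure Q) : Submodule ℝ (CCl Q) where
  carrier := {x | σ.toFun x = x}
  add_mem' := by
    intro a b ha hb
    simp only [Set.mem_setOf_eq] at *
    rw [σ.map_add', ha, hb]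
  zero_mem' := σ.map_zero'
  smul_mem' := by
    intro r x hx
    simp only [Set.mem_setOf_eq] at *
    rw [← Complex.coe_smul, σ.map_smul', hx]
    simp [Complex.conj_ofReal]

/-- `V_σ = {w ∈ V^ℂ : σ(w) = w}`, as a real submodule of `ℂl(V)`. -/
def VFix {Q : QuadraticForm ℝ V} (σ : RealStructure Q) : Submodule ℝ (CCl Q) :=
  (VC Q).restrictScalars ℝ ⊓ fixedPoints σ

/-- Multiplication by `i`, as a real-linear endomorphism of `ℂl(V)`. -/
def mulI (Q : QuadraticForm ℝ V) : CCl Q →ₗ[ℝ] CCl Q where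
  toFun x := Complex.I • x
  map_add' x y := smul_add _ x y
  map_smul' r x := smul_comm Complex.I r x

/-- The real subspace `V ⊆ V^ℂ ⊆ ℂl(V)`. -/
def Vreal (Q : QuadraticForm ℝ V) : Submodule ℝ (CCl Q) :=
  Submodule.span ℝ (Set.range (ιr Q))

/-- The canonical real structure `c` (characterized by fixing `V` pointwise). -/
def IsCanonicalC {Q : QuadraticForm ℝ V} (c : RealStructure Q) : Prop :=
  ∀ v : V, c.toFun (ιr Q v) = ιr Q v

/-- `σ` is admissible iff it commutes with the canonical real structure `c`. -/
def Admissible {Q : QuadraticForm ℝ V} (c σ : RealStructure Q) : Prop :=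
  ∀ x, σ.toFun (c.toFun x) = c.toFun (σ.toFun x)

/-- Nondegeneracy of a real quadratic form, via its polar form. -/
def QFNondeg (Q : QuadraticForm ℝ V) : Prop :=
  ∀ v : V, (∀ w : V, QuadraticMap.polar Q v w = 0) → v = 0

/-- The σ-product `(a,b)_σ = τ_n(σ(aᵀ)b)` on `ℂl(V)`. -/
def sprod {Q : QuadraticForm ℝ V} (σ : RealStructure Q) (τ : CCl Q →ₗ[ℂ] ℂ)
    (a b : CCl Q) : ℂ :=
  τ (σ.toFun (CliffordAlgebra.reverse a) * b)

section OrthogonalFamily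

variable {K A ι : Type*} [Field K] [Ring A] [Algebra K A] [LinearOrder ι]

/-- The ordered product `e_I` of the members of a family indexed by `I`. -/
def orderedProd (e : ι → A) (I : Finset ι) : A :=
  ((I.sort (· ≤ ·)).map e).prod

theorem mul_list_prod_of_anticomm {e : ι → A}
    (hanti : ∀ i j, i ≠ j → e i * e j + e j * e i = 0) (i : ι) (l : List ι) :
    e i * (l.map e).prod = (-1) ^ (l.length + l.count i) * ((l.map e).prod * e i) := by
  induction l with
  | nil => simp
  | cons a t ih =>
    have hc : ∀ k : ℕ, e a * (-1) ^ k = (-1) ^ k * e a := fun k =>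
      ((Commute.neg_one_right (e a)).pow_right k).eq
    rw [List.map_cons, List.prod_cons, List.length_cons, List.count_cons]
    by_cases h : a = i
    · subst h
      simp only [beq_self_eq_true, if_true]
      rw [show t.length + 1 + (t.count a + 1)
        = t.length + t.count a + 2 by ring, pow_add, neg_one_sq, mul_one, mul_assoc (e a)]
      nth_rw 1 [ih]
      rw [← mul_assoc (e a), hc, mul_assoc]
    · have hs : e i * e a = -(e a * e i) := eq_neg_of_add_eq_zero_left (hanti i a (Ne.symm h))
      rw [← mul_assoc, hs, neg_mul, mul_assoc, ih, ← mul_assoc (e a), hc]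
      simp only [beq_iff_eq, h, if_false]
      rw [show t.length + 1 + (t.count i + 0) = t.length + t.count i + 1 by ring, pow_succ]
      simp [mul_assoc]

/-- A trace vanishes on every word that anticommutes with some non-isotropic generator. -/
theorem trace_list_prod_eq_zero [NeZero (2 : K)] {e : ι → A} {q : ι → K}
    (hanti : ∀ i j, i ≠ j → e i * e j + e j * e i = 0)
    (hsq : ∀ i, e i * e i = algebraMap K A (q i)) (hq : ∀ i, q i ≠ 0)
    {τ : A →ₗ[K] K} (hτ : ∀ a b, τ (a * b) = τ (b * a)) {i : ι} {l : List ι}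
    (hi : Odd (l.length + l.count i)) : τ (l.map e).prod = 0 := by
  have h := mul_list_prod_of_anticomm hanti i l
  rw [hi.neg_one_pow, neg_one_mul] at h
  have h1 : τ (e i * ((l.map e).prod * e i)) = q i * τ (l.map e).prod := by
    rw [hτ, mul_assoc, hsq, ← Algebra.commutes, ← Algebra.smul_def, map_smul, smul_eq_mul]
  have h2 : τ (e i * ((l.map e).prod * e i)) = -(q i * τ (l.map e).prod) := by
    rw [← mul_assoc, h, neg_mul, mul_assoc, hsq, ← Algebra.commutes, ← Algebra.smul_def, map_neg,
      map_smul, smul_eq_mul]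
  have h3 : 2 * (q i * τ (l.map e).prod) = 0 := by
    linear_combination h2 - h1
  simpa [hq i, two_ne_zero] using h3

theorem trace_reverse_orderedProd_mul_eq_zero [NeZero (2 : K)] [Fintype ι]
    (hι : Even (Fintype.card ι)) {e : ι → A} {q : ι → K}
    (hanti : ∀ i j, i ≠ j → e i * e j + e j * e i = 0)
    (hsq : ∀ i, e i * e i = algebraMap K A (q i)) (hq : ∀ i, q i ≠ 0)
    {τ : A →ₗ[K] K} (hτ : ∀ a b, τ (a * b) = τ (b * a)) {I J : Finset ι} (hIJ : I ≠ J) :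
    τ (((I.sort (· ≤ ·)).map e).reverse.prod * orderedProd e J) = 0 := by
  have hcount : ∀ (S : Finset ι) (i : ι),
      (S.sort (· ≤ ·)).count i = if i ∈ S then 1 else 0 := fun S i => by
    rw [(S.sort_nodup _).count]
    simp
  rw [orderedProd, ← List.map_reverse, ← List.prod_append, ← List.map_append]
  by_contra hne
  have hpar : ∀ i, Even (I.card + J.card + ((if i ∈ I then 1 else 0) + if i ∈ J then 1 else 0)) :=
    fun i => by
    rw [← Nat.not_odd_iff_even]
    intro hodd
    refine hne (trace_list_prod_eq_zero hanti hsq hq hτ (i := i) ?_)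
    simpa [hcount] using hodd
  rcases Nat.even_or_odd (I.card + J.card) with hs | hs
  · apply hIJ
    ext i
    have := hpar i
    grind
  · have hJ : J = Iᶜ := by
      ext i
      have := hpar i
      rw [Finset.mem_compl]
      grind
    rw [hJ, Finset.card_add_card_compl] at hs
    exact (Nat.not_odd_iff_even.2 hι) hs

theorem reverse_list_prod_mul {κ : Type*} {e : κ → A} {q : κ → K} {l : List κ}
    (hsq : ∀ i ∈ l, e i * e i = algebraMap K A (q i)) :
    (l.map e).reverse.prod * (l.map e).prod = algebraMap K A (l.map q).prod := by
  induction l with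
  | nil => simp
  | cons a t ih =>
    rw [List.map_cons, List.map_cons, List.reverse_cons, List.prod_append, List.prod_cons,
      List.prod_cons, List.prod_nil, mul_one, mul_assoc, ← mul_assoc (e a),
      hsq a List.mem_cons_self, ← mul_assoc, ← Algebra.commutes, mul_assoc,
      ih fun i hi => hsq i (List.mem_cons_of_mem _ hi), List.prod_cons, map_mul]

theorem trace_reverse_orderedProd_mul_self {e : ι → A} {q : ι → K}
    (hsq : ∀ i, e i * e i = algebraMap K A (q i)) (hq : ∀ i, q i ≠ 0)
    {τ : A →ₗ[K] K} (hτ1 : τ 1 = 1) (I : Finset ι) :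
    τ (((I.sort (· ≤ ·)).map e).reverse.prod * orderedProd e I) ≠ 0 := by
  rw [orderedProd, reverse_list_prod_mul fun i _ => hsq i, Algebra.algebraMap_eq_smul_one,
    map_smul, hτ1, smul_eq_mul, mul_one]
  exact List.prod_ne_zero (by simp [hq])

theorem linearIndependent_orderedProd [NeZero (2 : K)] [Fintype ι]
    (hι : Even (Fintype.card ι)) {e : ι → A} {q : ι → K}
    (hanti : ∀ i j, i ≠ j → e i * e j + e j * e i = 0)
    (hsq : ∀ i, e i * e i = algebraMap K A (q i)) (hq : ∀ i, q i ≠ 0)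
    {τ : A →ₗ[K] K} (hτ1 : τ 1 = 1) (hτ : ∀ a b, τ (a * b) = τ (b * a)) :
    LinearIndependent K (orderedProd e) := by
  rw [Fintype.linearIndependent_iff]
  intro c hc J
  have h := congrArg (fun x => τ (((J.sort (· ≤ ·)).map e).reverse.prod * x)) hc
  simp only [Finset.mul_sum, map_sum, mul_smul_comm, map_smul, smul_eq_mul, mul_zero,
    map_zero] at h
  rw [Finset.sum_eq_single J] at h
  · exact (mul_eq_zero.1 h).resolve_right (trace_reverse_orderedProd_mul_self hsq hq hτ1 J)
  · intro I _ hIJ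
    rw [trace_reverse_orderedProd_mul_eq_zero hι hanti hsq hq hτ hIJ.symm, mul_zero]
  · simp

theorem eq_zero_of_trace_mul_eq_zero [NeZero (2 : K)] [Fintype ι]
    (hι : Even (Fintype.card ι)) {e : ι → A} {q : ι → K}
    (hanti : ∀ i j, i ≠ j → e i * e j + e j * e i = 0)
    (hsq : ∀ i, e i * e i = algebraMap K A (q i)) (hq : ∀ i, q i ≠ 0)
    (hspan : Submodule.span K (Set.range (orderedProd e)) = ⊤)
    {τ : A →ₗ[K] K} (hτ1 : τ 1 = 1) (hτ : ∀ a b, τ (a * b) = τ (b * a)) {a : A}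
    (ha : ∀ b, τ (a * b) = 0) : a = 0 := by
  obtain ⟨c, rfl⟩ := (Submodule.mem_span_range_iff_exists_fun K).1
    (hspan ▸ Submodule.mem_top : a ∈ Submodule.span K (Set.range (orderedProd e)))
  refine Finset.sum_eq_zero fun J _ => ?_
  have h := ha ((J.sort (· ≤ ·)).map e).reverse.prod
  rw [hτ] at h
  simp only [Finset.mul_sum, map_sum, mul_smul_comm, map_smul, smul_eq_mul] at h
  rw [Finset.sum_eq_single J] at h
  · rw [(mul_eq_zero.1 h).resolve_right (trace_reverse_orderedProd_mul_self hsq hq hτ1 J),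
      zero_smul]
  · intro I _ hIJ
    rw [trace_reverse_orderedProd_mul_eq_zero hι hanti hsq hq hτ hIJ.symm, mul_zero]
  · simp

theorem trace_unique [NeZero (2 : K)] [Fintype ι]
    (hι : Even (Fintype.card ι)) {e : ι → A} {q : ι → K}
    (hanti : ∀ i j, i ≠ j → e i * e j + e j * e i = 0)
    (hsq : ∀ i, e i * e i = algebraMap K A (q i)) (hq : ∀ i, q i ≠ 0)
    (hspan : Submodule.span K (Set.range (orderedProd e)) = ⊤)
    {τ τ' : A →ₗ[K] K} (hτ1 : τ 1 = 1) (hτ : ∀ a b, τ (a * b) = τ (b * a))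
    (hτ1' : τ' 1 = 1) (hτ' : ∀ a b, τ' (a * b) = τ' (b * a)) : τ = τ' := by
  refine LinearMap.ext_on_range hspan fun I => ?_
  by_cases hI : I = ∅
  · simp [hI, orderedProd, hτ1, hτ1']
  · have h := trace_reverse_orderedProd_mul_eq_zero hι hanti hsq hq hτ (Ne.symm hI)
    have h' := trace_reverse_orderedProd_mul_eq_zero hι hanti hsq hq hτ' (Ne.symm hI)
    simp only [Finset.sort_empty, List.map_nil, List.reverse_nil, List.prod_nil, one_mul] at h h'
    rw [h, h']

theorem exists_mul_sorted_list_prod {e : ι → A} {q : ι → K}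
    (hanti : ∀ i j, i ≠ j → e i * e j + e j * e i = 0)
    (hsq : ∀ i, e i * e i = algebraMap K A (q i)) (i : ι) {l : List ι}
    (hl : l.Pairwise (· < ·)) :
    ∃ (l' : List ι) (c : K), l'.Pairwise (· < ·) ∧ (∀ x ∈ l', x = i ∨ x ∈ l) ∧
      e i * (l.map e).prod = c • (l'.map e).prod := by
  induction l with
  | nil => exact ⟨[i], 1, by simp⟩
  | cons a t ih =>
    rw [List.pairwise_cons] at hl
    rcases lt_trichotomy i a with h | h | h
    · refine ⟨i :: a :: t, 1, ?_, by simp, by simp⟩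
      simp only [List.pairwise_cons, List.mem_cons]
      exact ⟨by rintro x (rfl | hx); exacts [h, h.trans (hl.1 x hx)], hl⟩
    · subst h
      refine ⟨t, q i, hl.2, fun x hx => Or.inr (List.mem_cons_of_mem _ hx), ?_⟩
      rw [List.map_cons, List.prod_cons, ← mul_assoc, hsq, Algebra.smul_def]
    · obtain ⟨l', c, hl', hmem, hprod⟩ := ih hl.2
      refine ⟨a :: l', -c, ?_, ?_, ?_⟩
      · rw [List.pairwise_cons]
        refine ⟨fun x hx => ?_, hl'⟩
        rcases hmem x hx with rfl | hx'
        exacts [h, hl.1 x hx']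
      · grind
      · have hs : e i * e a = -(e a * e i) := eq_neg_of_add_eq_zero_left (hanti i a h.ne')
        rw [List.map_cons, List.prod_cons, ← mul_assoc, hs, neg_mul, mul_assoc, hprod,
          List.map_cons, List.prod_cons, mul_smul_comm, neg_smul]

theorem span_orderedProd_eq_top {e : ι → A} {q : ι → K}
    (hanti : ∀ i j, i ≠ j → e i * e j + e j * e i = 0)
    (hsq : ∀ i, e i * e i = algebraMap K A (q i))
    (hgen : Algebra.adjoin K (Set.range e) = ⊤) :
    Submodule.span K (Set.range (orderedProd e)) = ⊤ := by
  have hmul : ∀ i, ∀ y ∈ Submodule.span K (Set.range (orderedProd e)),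
      e i * y ∈ Submodule.span K (Set.range (orderedProd e)) := fun i y hy => by
    induction hy using Submodule.span_induction with
    | mem y hy =>
      obtain ⟨I, rfl⟩ := hy
      obtain ⟨l', c, hl', -, h⟩ := exists_mul_sorted_list_prod hanti hsq i I.sortedLT_sort.pairwise
      rw [orderedProd, h]
      refine Submodule.smul_mem _ _ (Submodule.subset_span ⟨l'.toFinset, ?_⟩)
      rw [orderedProd, (List.toFinset_sort (· ≤ ·) hl'.nodup).2 (hl'.imp le_of_lt)]
    | zero => simp
    | add x y _ _ hx hy => rw [mul_add]; exact add_mem hx hy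
    | smul c x _ hx => rw [mul_smul_comm]; exact Submodule.smul_mem _ _ hx
  refine Submodule.eq_top_iff'.2 fun x => ?_
  have hx : ∀ y ∈ Submodule.span K (Set.range (orderedProd e)),
      x * y ∈ Submodule.span K (Set.range (orderedProd e)) := by
    have hadj : x ∈ Algebra.adjoin K (Set.range e) := hgen ▸ Algebra.mem_top
    induction hadj using Algebra.adjoin_induction with
    | mem x hx => obtain ⟨i, rfl⟩ := hx; exact hmul i
    | algebraMap r =>
      intro y hy
      rw [← Algebra.smul_def]
      exact Submodule.smul_mem _ _ hy
    | add x y _ _ hx hy => intro z hz; rw [add_mul]; exact add_mem (hx z hz) (hy z hz)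
    | mul x y _ _ hx hy => intro z hz; rw [mul_assoc]; exact hx _ (hy z hz)
  simpa using hx 1 (Submodule.subset_span ⟨∅, by simp [orderedProd]⟩)

end OrthogonalFamily

theorem adjoin_eq_top_of_VC_le_span {Q : QuadraticForm ℝ V} {ι : Type*} {e : ι → CCl Q}
    (h : VC Q ≤ Submodule.span ℂ (Set.range e)) : Algebra.adjoin ℂ (Set.range e) = ⊤ := by
  rw [eq_top_iff, ← CliffordAlgebra.adjoin_range_ι, Algebra.adjoin_le_iff]
  exact fun x hx => Algebra.span_le_adjoin ℂ _ (h hx)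

theorem mul_self_mem_VC {Q : QuadraticForm ℝ V} {x : CCl Q} (hx : x ∈ VC Q) :
    ∃ c : ℂ, x * x = algebraMap ℂ (CCl Q) c := by
  obtain ⟨m, rfl⟩ := hx
  exact ⟨_, CliffordAlgebra.ι_sq_scalar _ _⟩

theorem reverse_of_mem_VC {Q : QuadraticForm ℝ V} {x : CCl Q} (hx : x ∈ VC Q) :
    CliffordAlgebra.reverse x = x := by
  obtain ⟨m, rfl⟩ := hx
  exact CliffordAlgebra.reverse_ι m

theorem ιr_mem_VC (Q : QuadraticForm ℝ V) (v : V) : ιr Q v ∈ VC Q := ⟨_, rfl⟩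

theorem ιr_mul_self (Q : QuadraticForm ℝ V) (v : V) :
    ιr Q v * ιr Q v = algebraMap ℂ (CCl Q) (Q v : ℂ) := by
  rw [ιr, CliffordAlgebra.ι_sq_scalar, QuadraticForm.baseChange_tmul]
  simp

theorem ιr_mul_add_swap (Q : QuadraticForm ℝ V) (v w : V) :
    ιr Q v * ιr Q w + ιr Q w * ιr Q v
      = algebraMap ℂ (CCl Q) ((QuadraticMap.polar Q v w : ℝ) : ℂ) := by
  have hadd : ιr Q (v + w) = ιr Q v + ιr Q w := by
    simp [ιr, TensorProduct.tmul_add]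
  have h := ιr_mul_self Q (v + w)
  rw [hadd, mul_add, add_mul, add_mul, ιr_mul_self, ιr_mul_self] at h
  rw [QuadraticMap.polar, Complex.ofReal_sub, Complex.ofReal_sub, map_sub, map_sub, ← h]
  abel

/-- A nondegenerate real form has an orthogonal basis of non-isotropic vectors. -/
theorem exists_orthogonal_family [FiniteDimensional ℝ V] {Q : QuadraticForm ℝ V}
    (hQ : QFNondeg Q) :
    ∃ (e : Fin (Module.finrank ℝ V) → CCl Q) (q : Fin (Module.finrank ℝ V) → ℂ),
      (∀ i j, i ≠ j → e i * e j + e j * e i = 0) ∧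
      (∀ i, e i * e i = algebraMap ℂ (CCl Q) (q i)) ∧ (∀ i, q i ≠ 0) ∧
      VC Q ≤ Submodule.span ℂ (Set.range e) := by
  obtain ⟨b, hb⟩ := LinearMap.BilinForm.exists_orthogonal_basis
    (B := Q.polarBilin) ⟨fun x y => QuadraticMap.polar_comm Q x y⟩
  have hort : ∀ i j, i ≠ j → QuadraticMap.polar Q (b i) (b j) = 0 := fun i j hij => hb hij
  refine ⟨fun i => ιr Q (b i), fun i => (Q (b i) : ℂ), ?_, fun i => ιr_mul_self Q _, ?_, ?_⟩
  · intro i j hij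
    rw [ιr_mul_add_swap, hort i j hij]
    simp
  · intro i hi
    refine b.ne_zero i (hQ _ fun w => ?_)
    have hz : Q.polarBilin (b i) = 0 := by
      refine b.ext fun j => ?_
      by_cases hij : i = j
      · subst hij
        rw [QuadraticMap.polarBilin_apply_apply, QuadraticMap.polar_self]
        simp [Complex.ofReal_eq_zero.1 hi]
      · exact hort i j hij
    exact LinearMap.congr_fun hz w
  · rintro _ ⟨m, rfl⟩
    have hm : m ∈ Submodule.span ℂ (Set.range (b.baseChange ℂ)) :=
      (b.baseChange ℂ).mem_span m
    have h := Submodule.mem_map_of_mem (f := CliffordAlgebra.ι (Q.baseChange ℂ)) hm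
    rw [Submodule.map_span, ← Set.range_comp] at h
    have he : CliffordAlgebra.ι (Q.baseChange ℂ) ∘ b.baseChange ℂ = fun i => ιr Q (b i) := by
      ext i
      simp [ιr]
    rwa [he] at h

namespace RealStructure

variable {Q : QuadraticForm ℝ V} (σ : RealStructure Q)

theorem map_algebraMap (z : ℂ) :
    σ.toFun (algebraMap ℂ (CCl Q) z) = algebraMap ℂ (CCl Q) (starRingEnd ℂ z) := by
  rw [Algebra.algebraMap_eq_smul_one, σ.map_smul', σ.map_one', Algebra.algebraMap_eq_smul_one]

theorem map_reverse (x : CCl Q) :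
    σ.toFun (CliffordAlgebra.reverse x) = CliffordAlgebra.reverse (σ.toFun x) := by
  induction x using CliffordAlgebra.induction with
  | algebraMap r => simp [map_algebraMap]
  | ι m => rw [CliffordAlgebra.reverse_ι, reverse_of_mem_VC (σ.stable _ ⟨m, rfl⟩)]
  | mul a b ha hb =>
    rw [CliffordAlgebra.reverse.map_mul, σ.map_mul', σ.map_mul', CliffordAlgebra.reverse.map_mul,
      ha, hb]
  | add a b ha hb => rw [map_add, σ.map_add', σ.map_add', map_add, ha, hb]

theorem map_reverse_list_prod {l : List (CCl Q)} (hl : ∀ x ∈ l, x ∈ VFix σ) :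
    σ.toFun (CliffordAlgebra.reverse l.prod) = l.reverse.prod := by
  induction l with
  | nil => simp [σ.map_one']
  | cons a t ih =>
    obtain ⟨ha, ha'⟩ := hl a List.mem_cons_self
    rw [List.prod_cons, CliffordAlgebra.reverse.map_mul, σ.map_mul', reverse_of_mem_VC ha,
      ih fun x hx => hl x (List.mem_cons_of_mem _ hx), List.reverse_cons, List.prod_append,
      List.prod_singleton, show σ.toFun a = a from ha']

/-- The fixed vectors of a real structure form a real form of `V^ℂ`. -/
theorem VC_le_span_VFix : VC Q ≤ Submodule.span ℂ (VFix σ : Set (CCl Q)) := by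
  intro x hx
  have hadd : x + σ.toFun x ∈ VFix σ :=
    ⟨add_mem hx (σ.stable x hx), by
      change σ.toFun _ = _
      rw [σ.map_add', σ.invol, add_comm]⟩
  have hsub : Complex.I • (x - σ.toFun x) ∈ VFix σ :=
    ⟨(VC Q).smul_mem _ (sub_mem hx (σ.stable x hx)), by
      change σ.toFun _ = _
      have hneg : σ.toFun (-σ.toFun x) = -x := by
        rw [← neg_one_smul ℂ (σ.toFun x), σ.map_smul', σ.invol]
        simp
      rw [σ.map_smul', sub_eq_add_neg, σ.map_add', hneg, Complex.conj_I, neg_smul, ← smul_neg]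
      congr 1
      abel⟩
  have hx2 : x = (1 / 2 : ℂ) • (x + σ.toFun x)
      + (-Complex.I / 2) • (Complex.I • (x - σ.toFun x)) := by
    rw [smul_smul, show -Complex.I / 2 * Complex.I = 1 / 2 by
      linear_combination (-1 / 2 : ℂ) * Complex.I_mul_I, ← smul_add]
    rw [show x + σ.toFun x + (x - σ.toFun x) = (2 : ℂ) • x by rw [two_smul]; abel, smul_smul]
    norm_num
  rw [hx2]
  exact add_mem (Submodule.smul_mem _ _ (Submodule.subset_span hadd))
    (Submodule.smul_mem _ _ (Submodule.subset_span hsub))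

/-- The conjugate `conj ∘ τ ∘ σ` of a linear functional on `ℂl(V)`. -/
def conjFunctional (τ : CCl Q →ₗ[ℂ] ℂ) : CCl Q →ₗ[ℂ] ℂ where
  toFun x := starRingEnd ℂ (τ (σ.toFun x))
  map_add' x y := by rw [σ.map_add', map_add, map_add]
  map_smul' z x := by
    rw [σ.map_smul', map_smul, smul_eq_mul, map_mul, Complex.conj_conj, RingHom.id_apply,
      smul_eq_mul]

end RealStructure

theorem trace_algebraMap {Q : QuadraticForm ℝ V} {τ : CCl Q →ₗ[ℂ] ℂ} (hτ1 : τ 1 = 1) (z : ℂ) :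
    τ (algebraMap ℂ (CCl Q) z) = z := by
  rw [Algebra.algebraMap_eq_smul_one, map_smul, hτ1, smul_eq_mul, mul_one]

theorem algebraMap_sprod_list_prod {Q : QuadraticForm ℝ V} {τ : CCl Q →ₗ[ℂ] ℂ} (hτ1 : τ 1 = 1)
    (σ : RealStructure Q) {l : List (CCl Q)} (hl : ∀ x ∈ l, x ∈ VFix σ) :
    algebraMap ℂ (CCl Q) (sprod σ τ l.prod l.prod) = (l.map fun x => x * x).prod := by
  choose! c hc using fun x hx => mul_self_mem_VC (Q := Q) (x := x) (hx : x ∈ VC Q)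
  have hlc : ∀ x ∈ l, x * x = algebraMap ℂ (CCl Q) (c x) := fun x hx => hc x (hl x hx).1
  have h := reverse_list_prod_mul (e := id) hlc
  rw [List.map_id] at h
  rw [sprod, σ.map_reverse_list_prod hl, h, trace_algebraMap hτ1,
    map_list_prod, List.map_map]
  exact congrArg List.prod (List.map_congr_left fun x hx => (hlc x hx).symm)

/-- The σ-product is a nondegenerate hermitian sesquilinear form on `ℂl(V)`
restricting to `Q_σ` on `V` and to `Q` on `V_σ`; it is multiplicative on products of vectors
of `V_σ`, and a pseudo-orthonormal basis `(eᵢ)` of `V_σ` yields a pseudo-orthonormal basis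
`(e_I)` of `ℂl(V)` for the σ-product. -/
theorem statement4 [FiniteDimensional ℝ V] (Q : QuadraticForm ℝ V)
    (hdim : Even (Module.finrank ℝ V)) (hQ : QFNondeg Q)
    (τ : CCl Q →ₗ[ℂ] ℂ) (hτ1 : τ 1 = 1) (hτtr : ∀ a b : CCl Q, τ (a * b) = τ (b * a))
    (σ : RealStructure Q) :
    -- hermitian
    (∀ a b : CCl Q, sprod σ τ b a = starRingEnd ℂ (sprod σ τ a b))
    -- nondegenerate
    ∧ (∀ a : CCl Q, (∀ b : CCl Q, sprod σ τ a b = 0) → a = 0)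
    -- (v,v)_σ = Q_σ(v) = B(σ(v),v) for v ∈ V
    ∧ (∀ v : V, algebraMap ℂ (CCl Q) (2 * sprod σ τ (ιr Q v) (ιr Q v))
        = σ.toFun (ιr Q v) * ιr Q v + ιr Q v * σ.toFun (ιr Q v))
    -- (w,w)_σ = Q(w) for w ∈ V_σ
    ∧ (∀ w ∈ VFix σ, algebraMap ℂ (CCl Q) (sprod σ τ w w) = w * w)
    -- multiplicativity on products of elements of V_σ
    ∧ (∀ (r : ℕ) (w : Fin r → CCl Q), (∀ i, w i ∈ VFix σ) →
        algebraMap ℂ (CCl Q)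
            (sprod σ τ (List.ofFn fun i => w i).prod (List.ofFn fun i => w i).prod)
          = (List.ofFn fun i => w i * w i).prod)
    -- pseudo-orthonormal basis of V_σ gives a pseudo-orthonormal basis of ℂl(V)
    ∧ (∀ e : Fin (Module.finrank ℝ V) → CCl Q,
        (∀ i, e i ∈ VFix σ) →
        (∀ i j, i ≠ j → e i * e j + e j * e i = 0) →
        (∀ i, e i * e i = 1 ∨ e i * e i = -1) →
        LinearIndependent ℝ e →
        Submodule.span ℝ (Set.range e) = VFix σ →
        (∀ I J : Finset (Fin (Module.finrank ℝ V)), I ≠ J →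
            sprod σ τ ((I.sort (· ≤ ·)).map e).prod ((J.sort (· ≤ ·)).map e).prod = 0)
        ∧ (∀ I : Finset (Fin (Module.finrank ℝ V)),
            sprod σ τ ((I.sort (· ≤ ·)).map e).prod ((I.sort (· ≤ ·)).map e).prod = 1
            ∨ sprod σ τ ((I.sort (· ≤ ·)).map e).prod ((I.sort (· ≤ ·)).map e).prod = -1)
        ∧ LinearIndependent ℂ
            (fun I : Finset (Fin (Module.finrank ℝ V)) => ((I.sort (· ≤ ·)).map e).prod)
        ∧ Submodule.span ℂ
            (Set.range fun I : Finset (Fin (Module.finrank ℝ V)) =>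
              ((I.sort (· ≤ ·)).map e).prod) = ⊤) := by
  obtain ⟨f, q, hanti, hsq, hq, hVC⟩ := exists_orthogonal_family hQ
  have hι : Even (Fintype.card (Fin (Module.finrank ℝ V))) := by rwa [Fintype.card_fin]
  have hspan := span_orderedProd_eq_top hanti hsq (adjoin_eq_top_of_VC_le_span hVC)
  have hconj : σ.conjFunctional τ = τ :=
    trace_unique hι hanti hsq hq hspan
      (by simp [RealStructure.conjFunctional, σ.map_one', hτ1])
      (fun a b => by simp [RealStructure.conjFunctional, σ.map_mul', hτtr (σ.toFun a)]) hτ1 hτtr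
  have hrev : τ ∘ₗ CliffordAlgebra.reverse = τ :=
    trace_unique hι hanti hsq hq hspan (by simp [hτ1])
      (fun a b => by simp [CliffordAlgebra.reverse.map_mul, hτtr (CliffordAlgebra.reverse a)])
      hτ1 hτtr
  have hword : ∀ l : List (CCl Q), (∀ x ∈ l, x ∈ VFix σ) →
      algebraMap ℂ (CCl Q) (sprod σ τ l.prod l.prod) = (l.map fun x => x * x).prod :=
    fun l hl => algebraMap_sprod_list_prod hτ1 σ hl
  have hinj : Function.Injective (algebraMap ℂ (CCl Q)) := fun x y hxy => by
    simpa [trace_algebraMap hτ1] using congrArg τ hxy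
  refine ⟨?_, ?_, ?_, ?_, ?_, ?_⟩
  · intro a b
    calc sprod σ τ b a = τ (CliffordAlgebra.reverse (σ.toFun (CliffordAlgebra.reverse b) * a)) :=
          (LinearMap.congr_fun hrev _).symm
      _ = τ (CliffordAlgebra.reverse a * σ.toFun b) := by
          rw [CliffordAlgebra.reverse.map_mul, σ.map_reverse, CliffordAlgebra.reverse_reverse]
      _ = starRingEnd ℂ (τ (σ.toFun (CliffordAlgebra.reverse a * σ.toFun b))) :=
          (LinearMap.congr_fun hconj _).symm
      _ = starRingEnd ℂ (sprod σ τ a b) := by rw [σ.map_mul', σ.invol, sprod]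
  · intro a ha
    have h := eq_zero_of_trace_mul_eq_zero hι hanti hsq hq hspan hτ1 hτtr ha
    have h' := congrArg σ.toFun h
    rw [σ.invol, σ.map_zero'] at h'
    rw [← CliffordAlgebra.reverse_reverse a, h', map_zero]
  · intro v
    obtain ⟨m, hm⟩ := σ.stable _ (ιr_mem_VC Q v)
    obtain ⟨z, h⟩ : ∃ z, σ.toFun (ιr Q v) * ιr Q v + ιr Q v * σ.toFun (ιr Q v)
        = algebraMap ℂ (CCl Q) z := by
      rw [← hm]
      exact ⟨_, CliffordAlgebra.ι_mul_ι_add_swap m _⟩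
    have h2 := congrArg τ h
    rw [trace_algebraMap hτ1, map_add, hτtr (ιr Q v), ← two_mul] at h2
    rw [sprod, reverse_of_mem_VC (ιr_mem_VC Q v), h2, h]
  · intro w hw
    simpa using hword [w] (by simpa using hw)
  · intro r w hw
    rw [hword _ (by simpa [List.mem_ofFn] using hw), List.map_ofFn]
    rfl
  · intro e he heanti hesq _ hespan
    have hq' : ∀ i, ∃ z : ℂ, z ≠ 0 ∧ e i * e i = algebraMap ℂ (CCl Q) z := fun i => by
      rcases hesq i with h | h
      · exact ⟨1, one_ne_zero, by simp [h]⟩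
      · exact ⟨-1, by simp, by simp [h]⟩
    choose q' hq0 hsq' using hq'
    have hmem : ∀ I : Finset (Fin (Module.finrank ℝ V)),
        ∀ x ∈ (I.sort (· ≤ ·)).map e, x ∈ VFix σ := fun I x hx => by
      obtain ⟨i, -, rfl⟩ := List.mem_map.1 hx
      exact he i
    refine ⟨fun I J hIJ => ?_, fun I => ?_,
      linearIndependent_orderedProd hι heanti hsq' hq0 hτ1 hτtr,
      span_orderedProd_eq_top heanti hsq' (adjoin_eq_top_of_VC_le_span ?_)⟩
    · rw [sprod, σ.map_reverse_list_prod (hmem I)]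
      exact trace_reverse_orderedProd_mul_eq_zero hι heanti hsq' hq0 hτtr hIJ
    · have hsign : ∀ l : List (Fin (Module.finrank ℝ V)),
          ((l.map e).map fun x => x * x).prod = 1 ∨ ((l.map e).map fun x => x * x).prod = -1 :=
        fun l => by
        induction l with
        | nil => simp
        | cons a t ih => rcases hesq a with h | h <;> rcases ih with h' | h' <;> simp_all
      have h := hword _ (hmem I)
      rcases hsign (I.sort (· ≤ ·)) with h1 | h1
      · exact Or.inl (hinj (by rw [h, h1, map_one]))
      · exact Or.inr (hinj (by rw [h, h1, map_neg, map_one]))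
    · refine σ.VC_le_span_VFix.trans ?_
      rw [← hespan, Submodule.span_span_of_tower]
end
end

section
/- (Robinson's transfer principle) Let σ be a real structure on ℂl(V) and let ρ : ℂl(V) → End(K) be a nonzero representation on a finite-dimensional complex vector space K. Then there exists a nondegenerate hermitian form (·,·)^K_σ on K that is σ-compatible, i.e., (ρ(a)ψ, φ)^K_σ = (ψ, ρ(a^{×_σ})φ)^K_σ for all a ∈ ℂl(V) and ψ, φ ∈ K. If ρ is irreducible, this form is unique up to multiplication by a nonzero real number. -/
noncomputable section

open TensorProduct

variable {V : Type*} [AddCommGroup V] [Module ℝ V]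

/-- A hermitian sesquilinear form (conjugate-linear in the first argument). -/
structure SesqForm (K : Type*) [AddCommGroup K] [Module ℂ K] where
  form : K → K → ℂ
  add_left : ∀ x y z : K, form (x + y) z = form x z + form y z
  add_right : ∀ x y z : K, form x (y + z) = form x y + form x z
  smul_left : ∀ (a : ℂ) (x y : K), form (a • x) y = starRingEnd ℂ a * form x y
  smul_right : ∀ (a : ℂ) (x y : K), form x (a • y) = a * form x y
  herm : ∀ x y : K, form y x = starRingEnd ℂ (form x y)

section KreinDefs

variable {K : Type*} [AddCommGroup K] [Module ℂ K]

/-- Nondegeneracy: a nondegenerate hermitian form is a Krein product. -/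
def SesqForm.Nondeg (h : SesqForm K) : Prop :=
  ∀ x : K, (∀ y : K, h.form x y = 0) → x = 0

/-- Positive definiteness of a sesquilinear form. -/
def FPosDef (f : K → K → ℂ) : Prop := ∀ x : K, x ≠ 0 → ∃ r : ℝ, 0 < r ∧ f x x = r

/-- Negative definiteness of a sesquilinear form. -/
def FNegDef (f : K → K → ℂ) : Prop := ∀ x : K, x ≠ 0 → ∃ r : ℝ, r < 0 ∧ f x x = r

/-- Definiteness of a sesquilinear form. -/
def FDefinite (f : K → K → ℂ) : Prop := FPosDef f ∨ FNegDef f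

/-- `f` is neutral: it admits an orthogonal decomposition into a positive definite
and a negative definite part of equal dimensions (equal indices of inertia). -/
def FNeutral (f : K → K → ℂ) : Prop :=
  ∃ P N : Submodule ℂ K, P ⊓ N = ⊥ ∧ P ⊔ N = ⊤
    ∧ (∀ x ∈ P, ∀ y ∈ N, f x y = 0)
    ∧ (∀ x ∈ P, x ≠ 0 → ∃ r : ℝ, 0 < r ∧ f x x = r)
    ∧ (∀ y ∈ N, y ≠ 0 → ∃ r : ℝ, r < 0 ∧ f y y = r)
    ∧ Module.finrank ℂ P = Module.finrank ℂ N

end KreinDefs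

section Rep

variable {V : Type*} [AddCommGroup V] [Module ℝ V]
variable {Q : QuadraticForm ℝ V} {K : Type*} [AddCommGroup K] [Module ℂ K]

/-- σ-compatibility of a representation with a hermitian form:
`(ρ(a)ψ, φ) = (ψ, ρ(a^{×_σ})φ)` where `a^{×_σ} = σ(aᵀ)`. -/
def Compat (σ : RealStructure Q) (ρ : CCl Q →ₐ[ℂ] Module.End ℂ K)
    (h : SesqForm K) : Prop :=
  ∀ (a : CCl Q) (ψ φ : K),
    h.form (ρ a ψ) φ = h.form ψ (ρ (σ.toFun (CliffordAlgebra.reverse a)) φ)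

/-- Irreducibility of a representation: `K` is a simple module. -/
def IsIrreducibleRep (ρ : CCl Q →ₐ[ℂ] Module.End ℂ K) : Prop :=
  (∃ x : K, x ≠ 0) ∧
    ∀ p : Submodule ℂ K, (∀ a : CCl Q, ∀ x ∈ p, ρ a x ∈ p) → p = ⊥ ∨ p = ⊤

end Rep

open Polynomial in
/-- A matrix pencil `A + t B` that is invertible at some complex parameter is invertible at some
real parameter. -/
theorem exists_real_det_add_smul_ne_zero {m : Type*} [Fintype m] [DecidableEq m]
    (A B : Matrix m m ℂ) (z : ℂ) (hz : (A + z • B).det ≠ 0) :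
    ∃ t : ℝ, (A + (t : ℂ) • B).det ≠ 0 := by
  set p : ℂ[X] := (A.map C + (X : ℂ[X]) • B.map C).det with hp
  have heval (w : ℂ) : p.eval w = (A + w • B).det := by
    rw [hp, ← coe_evalRingHom, RingHom.map_det]
    congr 1
    ext i j
    simp
    ring
  by_contra! h
  have hp0 : p = 0 := by
    refine p.eq_zero_of_infinite_isRoot ((Set.infinite_range_of_injective
      Complex.ofReal_injective).mono ?_)
    rintro _ ⟨t, rfl⟩
    exact (heval t).trans (h t)
  exact hz (by rw [← heval, hp0, eval_zero])

/-- A family of anticommuting square roots of the identity on `E`. -/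
structure IsGammaFamily {E : Type*} [AddCommGroup E] [Module ℂ E] {n : ℕ}
    (Γ : Fin n → Module.End ℂ E) : Prop where
  sq : ∀ i x, Γ i (Γ i x) = x
  anti : ∀ i j, i ≠ j → ∀ x, Γ i (Γ j x) = -Γ j (Γ i x)

/-- Splitting off the first two members of an anticommuting family: the space is `P × P`, the
first two members act as fixed matrices, and the others act through a shorter family on `P`. -/
theorem IsGammaFamily.exists_split {E : Type*} [AddCommGroup E] [Module ℂ E] {n : ℕ}
    {Γ : Fin (n + 2) → Module.End ℂ E} (hΓ : IsGammaFamily Γ) :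
    ∃ (P : Submodule ℂ E) (e : (P × P) ≃ₗ[ℂ] E) (Δ : Fin n → Module.End ℂ P),
      IsGammaFamily Δ ∧ ∀ x y : P, Γ 0 (e (x, y)) = e (y, x) ∧
        Γ 1 (e (x, y)) = e (Complex.I • y, -(Complex.I • x)) ∧
        ∀ j : Fin n, Γ j.succ.succ (e (x, y)) = e (Δ j x, -Δ j y) := by
  have h01 (x : E) : Γ 1 (Γ 0 x) = -Γ 0 (Γ 1 x) := hΓ.anti 1 0 (by simp) x
  have hj0 (j : Fin n) (x : E) : Γ j.succ.succ (Γ 0 x) = -Γ 0 (Γ j.succ.succ x) :=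
    hΓ.anti _ _ (by simp [Fin.ext_iff]) x
  have hj1 (j : Fin n) (x : E) : Γ j.succ.succ (Γ 1 x) = -Γ 1 (Γ j.succ.succ x) :=
    hΓ.anti _ _ (by simp [Fin.ext_iff]) x
  let P : Submodule ℂ E := LinearMap.ker (Γ 1 + Complex.I • Γ 0)
  have hP {x : E} : x ∈ P ↔ Γ 1 x = -(Complex.I • Γ 0 x) := by
    simp [P, add_eq_zero_iff_eq_neg]
  have hI (x : E) : Complex.I • Complex.I • x = -x := by
    rw [smul_smul, Complex.I_mul_I, neg_one_smul]
  let q : E →ₗ[ℂ] E := (2⁻¹ : ℂ) • (LinearMap.id + Complex.I • (Γ 0 ∘ₗ Γ 1))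
  have hq (x : E) : q x = (2⁻¹ : ℂ) • (x + Complex.I • Γ 0 (Γ 1 x)) := rfl
  have hqP (x : E) : q x ∈ P := by
    rw [hP, hq]
    simp only [map_smul, map_add, h01, hΓ.sq, smul_add, smul_neg, smul_comm Complex.I, hI]
    module
  let p : E →ₗ[ℂ] P := q.codRestrict P hqP
  have hpq (x : E) : (p x : E) = q x := rfl
  let f : (P × P) →ₗ[ℂ] E := P.subtype.coprod (Γ 0 ∘ₗ P.subtype)
  have hf (x y : P) : f (x, y) = x + Γ 0 y := rfl
  let e : (P × P) ≃ₗ[ℂ] E := LinearEquiv.ofLinearMap f (p.prod (p ∘ₗ Γ 0))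
    (by
      ext x
      simp only [LinearMap.comp_apply, LinearMap.prod_apply, Function.prod_apply, hf, hpq, hq,
        LinearMap.id_apply, map_smul, map_add, hΓ.sq, h01, map_neg, smul_neg]
      module)
    (by
      refine LinearMap.ext fun ⟨x, y⟩ => Prod.ext (Subtype.ext ?_) (Subtype.ext ?_) <;>
      · have hx := hP.1 x.2
        have hy := hP.1 y.2
        simp only [LinearMap.comp_apply, LinearMap.prod_apply, Function.prod_apply, hf,
          LinearMap.id_apply, hpq, hq, map_add, hΓ.sq, h01, hx, hy, map_neg, map_smul, smul_neg,
          neg_neg, smul_add, hI, Prod.fst_add, Prod.snd_add, Submodule.coe_add]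
        module)
  have he (x y : P) : e (x, y) = x + Γ 0 y := rfl
  have hΔP (j : Fin n) (x : E) (hx : x ∈ P) : Γ j.succ.succ x ∈ P := by
    rw [hP] at hx ⊢
    have := congrArg (Γ j.succ.succ) hx
    rw [hj1, map_neg, map_smul, hj0, smul_neg] at this
    rw [← neg_eq_iff_eq_neg.2 this.symm]
    simp_all
  refine ⟨P, e, fun j => (Γ j.succ.succ).restrict (hΔP j), ⟨fun i x => ?_, fun i j hij x => ?_⟩,
    fun x y => ⟨?_, ?_, fun j => ?_⟩⟩
  · exact Subtype.ext (hΓ.sq _ _)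
  · exact Subtype.ext (hΓ.anti _ _ (by simpa using hij) _)
  · rw [he, he, map_add, hΓ.sq, add_comm]
  · rw [he, he, map_add, h01, hP.1 x.2, hP.1 y.2]
    simp only [map_neg, map_smul, hΓ.sq, Submodule.coe_neg, Submodule.coe_smul, neg_neg]
    abel
  · rw [he, he, map_add, hj0]
    simp

/-- Two anticommuting families of the same even length on spaces of the same finite dimension are
equivalent. -/
theorem IsGammaFamily.exists_intertwiner (k : ℕ) :
    ∀ {E F : Type*} [AddCommGroup E] [Module ℂ E] [FiniteDimensional ℂ E]
      [AddCommGroup F] [Module ℂ F] [FiniteDimensional ℂ F]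
      {Γ : Fin (2 * k) → Module.End ℂ E} {Γ' : Fin (2 * k) → Module.End ℂ F},
      IsGammaFamily Γ → IsGammaFamily Γ' → Module.finrank ℂ E = Module.finrank ℂ F →
      ∃ T : E ≃ₗ[ℂ] F, ∀ i x, T (Γ i x) = Γ' i (T x) := by
  induction k with
  | zero =>
    intro E F _ _ _ _ _ _ Γ Γ' _ _ hd
    exact ⟨LinearEquiv.ofFinrankEq E F hd, fun i => i.elim0⟩
  | succ k ih =>
    intro E F _ _ _ _ _ _ Γ Γ' hΓ hΓ' hd
    obtain ⟨P, e, Δ, hΔ, h⟩ := IsGammaFamily.exists_split (n := 2 * k) hΓ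
    obtain ⟨P', e', Δ', hΔ', h'⟩ := IsGammaFamily.exists_split (n := 2 * k) hΓ'
    have hd' : Module.finrank ℂ P = Module.finrank ℂ P' := by
      have h₁ := e.finrank_eq
      have h₂ := e'.finrank_eq
      rw [Module.finrank_prod] at h₁ h₂
      omega
    obtain ⟨T, hT⟩ := ih hΔ hΔ' hd'
    refine ⟨e.symm ≪≫ₗ (T.prodCongr T) ≪≫ₗ e', fun i z => ?_⟩
    obtain ⟨⟨x, y⟩, rfl⟩ := e.surjective z
    obtain ⟨h0, h1, hj⟩ := h x y
    obtain ⟨h0', h1', hj'⟩ := h' (T x) (T y)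
    induction i using Fin.cases (n := 2 * k + 1) with
    | zero => simp [h0, h0']
    | succ i =>
      induction i using Fin.cases (n := 2 * k) with
      | zero => simp [h1, h1']
      | succ i => simp [hj, hj', hT]

/-- The complexification of a nondegenerate real quadratic form has an orthonormal basis. -/
theorem QFNondeg.exists_orthonormal_basis [FiniteDimensional ℝ V] {Q : QuadraticForm ℝ V}
    (hQ : QFNondeg Q) :
    ∃ b : Module.Basis (Fin (Module.finrank ℝ V)) ℂ (ℂ ⊗[ℝ] V),
      (∀ i, Q.baseChange ℂ (b i) = 1) ∧ ∀ i j, i ≠ j → (Q.baseChange ℂ).IsOrtho (b i) (b j) := by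
  obtain ⟨v, hv⟩ := LinearMap.BilinForm.exists_orthogonal_basis
    (QuadraticForm.associated_isSymm ℝ Q)
  have hortho (i j) (hij : i ≠ j) : Q.IsOrtho (v i) (v j) :=
    QuadraticMap.associated_isOrtho.1 (hv hij)
  have hpolar (i j) (hij : i ≠ j) : QuadraticMap.polar Q (v i) (v j) = 0 :=
    (hortho i j hij).polar_eq_zero
  have hne (i) : Q (v i) ≠ 0 := by
    intro h0
    refine v.ne_zero i (hQ _ fun w => ?_)
    have : QuadraticMap.polarBilin Q (v i) = 0 := by
      refine v.ext fun j => ?_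
      by_cases hij : i = j
      · subst hij
        simp [QuadraticMap.polar_self, h0]
      · simpa using hpolar i j hij
    simpa using LinearMap.congr_fun this w
  choose s hs using fun i => IsAlgClosed.exists_pow_nat_eq ((Q (v i) : ℂ)⁻¹) two_pos
  have hs0 (i) : s i ≠ 0 := by
    intro h
    have := hs i
    rw [h, zero_pow two_ne_zero, eq_comm, inv_eq_zero] at this
    exact hne i (by exact_mod_cast this)
  refine ⟨(v.baseChange ℂ).isUnitSMul fun i => (hs0 i).isUnit, fun i => ?_, fun i j hij => ?_⟩
  · rw [Module.Basis.isUnitSMul_apply, QuadraticMap.map_smul, Module.Basis.baseChange_apply,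
      QuadraticForm.baseChange_tmul, ← sq, hs]
    simp [hne]
  · rw [Module.Basis.isUnitSMul_apply, Module.Basis.isUnitSMul_apply,
      QuadraticMap.isOrtho_def, ← sub_eq_zero, ← sub_sub]
    change QuadraticMap.polar _ _ _ = 0
    rw [QuadraticMap.polar_smul_left, QuadraticMap.polar_smul_right, Module.Basis.baseChange_apply,
      Module.Basis.baseChange_apply, ← QuadraticMap.polarBilin_apply_apply,
      QuadraticForm.polarBilin_baseChange]
    simp [hpolar i j hij]

namespace RealStructure

variable {Q : QuadraticForm ℝ V} (σ : RealStructure Q)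

theorem map_neg' (x : CCl Q) : σ.toFun (-x) = -σ.toFun x := by
  simpa using σ.map_smul' (-1) x

/-- The operation `a ↦ σ(aᵀ)`. -/
def cross (a : CCl Q) : CCl Q := σ.toFun (CliffordAlgebra.reverse a)

theorem cross_add (a b : CCl Q) : σ.cross (a + b) = σ.cross a + σ.cross b := by
  simp [cross, σ.map_add']

theorem cross_mul (a b : CCl Q) : σ.cross (a * b) = σ.cross b * σ.cross a := by
  simp [cross, σ.map_mul', CliffordAlgebra.reverse.map_mul]

theorem cross_algebraMap (z : ℂ) :
    σ.cross (algebraMap ℂ (CCl Q) z) = algebraMap ℂ (CCl Q) (starRingEnd ℂ z) := by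
  simp [cross, map_algebraMap]

theorem cross_smul (z : ℂ) (a : CCl Q) : σ.cross (z • a) = starRingEnd ℂ z • σ.cross a := by
  simp [cross, σ.map_smul']

theorem cross_ι (x : ℂ ⊗[ℝ] V) :
    σ.cross (CliffordAlgebra.ι _ x) = σ.toFun (CliffordAlgebra.ι (Q.baseChange ℂ) x) := by
  simp [cross]

theorem cross_cross (a : CCl Q) : σ.cross (σ.cross a) = a := by
  induction a using CliffordAlgebra.induction with
  | algebraMap r => simp [cross_algebraMap]
  | ι x =>
    obtain ⟨y, hy⟩ := σ.stable _ ⟨x, rfl⟩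
    rw [cross_ι, ← hy, cross_ι, hy, σ.invol]
  | mul a b ha hb => rw [cross_mul, cross_mul, ha, hb]
  | add a b ha hb => rw [cross_add, cross_add, ha, hb]

end RealStructure

/-- Anticommuting square roots of `1` in the Clifford algebra give an anticommuting family. -/
theorem isGammaFamily_of_algHom {A E : Type*} [Ring A] [Algebra ℂ A] [AddCommGroup E] [Module ℂ E]
    {n : ℕ} (ρ : A →ₐ[ℂ] Module.End ℂ E) {g : Fin n → A} (hsq : ∀ i, g i * g i = 1)
    (hanti : ∀ i j, i ≠ j → g i * g j = -(g j * g i)) : IsGammaFamily fun i => ρ (g i) where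
  sq i x := by rw [← Module.End.mul_apply, ← map_mul, hsq, map_one, Module.End.one_apply]
  anti i j hij x := by
    rw [← Module.End.mul_apply, ← map_mul, hanti i j hij, map_neg, map_mul]
    rfl

open Matrix in
/-- For a matrix representation of `ℂl(V)` there is an invertible matrix intertwining it with its
`σ`-contragredient. -/
theorem RealStructure.exists_intertwining_matrix [FiniteDimensional ℝ V] {Q : QuadraticForm ℝ V}
    (hdim : Even (Module.finrank ℝ V)) (hQ : QFNondeg Q) (σ : RealStructure Q)
    {m : Type*} [Fintype m] [DecidableEq m] (M : CCl Q →ₐ[ℂ] Matrix m m ℂ) :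
    ∃ T : Matrix m m ℂ, T.det ≠ 0 ∧ ∀ a, T * M a = (M (σ.cross a))ᴴ * T := by
  have hb := hQ.exists_orthonormal_basis
  obtain ⟨k, hk⟩ := hdim.two_dvd
  rw [hk] at hb
  obtain ⟨b, hb1, hb0⟩ := hb
  let g (i : Fin (2 * k)) : CCl Q := CliffordAlgebra.ι _ (b i)
  have hsq (i) : g i * g i = 1 := by simp [g, hb1]
  have hanti (i j) (hij : i ≠ j) : g i * g j = -(g j * g i) :=
    CliffordAlgebra.ι_mul_ι_comm_of_isOrtho (hb0 i j hij)
  let N (i : Fin (2 * k)) : Matrix m m ℂ := (M (σ.toFun (g i)))ᴴ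
  have hNsq (i) : N i * N i = 1 := by
    simp only [N]
    rw [← conjTranspose_mul, ← map_mul, ← σ.map_mul', hsq, σ.map_one', map_one,
      conjTranspose_one]
  have hNanti (i j) (hij : i ≠ j) : N i * N j = -(N j * N i) := by
    simp only [N]
    rw [← conjTranspose_mul, ← conjTranspose_mul, ← map_mul, ← map_mul, ← σ.map_mul',
      ← σ.map_mul', hanti j i hij.symm, σ.map_neg', map_neg, conjTranspose_neg]
  obtain ⟨T₀, hT₀⟩ := IsGammaFamily.exists_intertwiner k
    (isGammaFamily_of_algHom ((toLinAlgEquiv' : Matrix m m ℂ ≃ₐ[ℂ] _).toAlgHom.comp M) hsq hanti)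
    (isGammaFamily_of_algHom (toLinAlgEquiv' : Matrix m m ℂ ≃ₐ[ℂ] _).toAlgHom hNsq hNanti) rfl
  let T : Matrix m m ℂ := LinearMap.toMatrix' T₀.toLinearMap
  have hTv (x : m → ℂ) : T *ᵥ x = T₀ x := LinearMap.toMatrix'_mulVec _ _
  have hT (i) : T * M (g i) = N i * T := by
    refine ext_of_mulVec_single fun j => ?_
    rw [← mulVec_mulVec, ← mulVec_mulVec, hTv, hTv]
    exact hT₀ i _
  have hdet : T.det ≠ 0 := by
    rw [LinearMap.det_toMatrix']
    exact T₀.isUnit_det'.ne_zero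
  refine ⟨T, hdet, fun a => ?_⟩
  induction a using CliffordAlgebra.induction with
  | algebraMap r =>
    rw [σ.cross_algebraMap, AlgHom.commutes, AlgHom.commutes, Algebra.algebraMap_eq_smul_one,
      Algebra.algebraMap_eq_smul_one]
    simp
  | ι x =>
    have hx : x ∈ Submodule.span ℂ (Set.range b) := b.mem_span x
    induction hx using Submodule.span_induction with
    | mem x hx =>
      obtain ⟨i, rfl⟩ := hx
      rw [σ.cross_ι]
      exact hT i
    | zero => simp [RealStructure.cross, σ.map_zero']
    | add x y _ _ hx hy =>
      simp only [map_add, σ.cross_add, mul_add, add_mul, conjTranspose_add, hx, hy]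
    | smul z x _ hx => simp [σ.cross_smul, hx]
  | mul a c ha hc =>
    rw [σ.cross_mul, map_mul, map_mul, conjTranspose_mul, ← mul_assoc, ha, mul_assoc, hc,
      mul_assoc]
  | add a c ha hc => simp only [map_add, σ.cross_add, mul_add, add_mul, conjTranspose_add, ha, hc]

open Matrix in
/-- For a matrix representation of `ℂl(V)` there is an invertible hermitian matrix intertwining it
with its `σ`-contragredient. -/
theorem RealStructure.exists_isHermitian_matrix [FiniteDimensional ℝ V] {Q : QuadraticForm ℝ V}
    (hdim : Even (Module.finrank ℝ V)) (hQ : QFNondeg Q) (σ : RealStructure Q)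
    {m : Type*} [Fintype m] [DecidableEq m] (M : CCl Q →ₐ[ℂ] Matrix m m ℂ) :
    ∃ H : Matrix m m ℂ, H.IsHermitian ∧ H.det ≠ 0 ∧ ∀ a, (M a)ᴴ * H = H * M (σ.cross a) := by
  obtain ⟨T, hdet, hT⟩ := σ.exists_intertwining_matrix hdim hQ M
  have hT' (a) : (M a)ᴴ * T = T * M (σ.cross a) := by rw [hT, σ.cross_cross]
  have hT'' (a) : (M a)ᴴ * Tᴴ = Tᴴ * M (σ.cross a) := by
    simpa using congrArg conjTranspose (hT a)
  obtain ⟨t, ht⟩ := exists_real_det_add_smul_ne_zero (T + Tᴴ) (Complex.I • (T - Tᴴ))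
    (-Complex.I) (by
      have : T + Tᴴ + -Complex.I • Complex.I • (T - Tᴴ) = (2 : ℂ) • T := by
        rw [smul_smul, neg_mul, Complex.I_mul_I]
        module
      rw [this, det_smul]
      exact mul_ne_zero (pow_ne_zero _ two_ne_zero) hdet)
  refine ⟨_, ?_, ht, fun a => ?_⟩
  · simp only [IsHermitian, conjTranspose_add, conjTranspose_smul, conjTranspose_sub,
      conjTranspose_conjTranspose, Complex.star_def, Complex.conj_I, Complex.conj_ofReal]
    module
  · simp only [mul_add, add_mul, mul_sub, sub_mul, mul_smul_comm, smul_mul_assoc, hT', hT'']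

open Matrix in
/-- The hermitian form on `K` with a given Gram matrix in a given basis. -/
def SesqForm.ofMatrix {K m : Type*} [AddCommGroup K] [Module ℂ K] [Fintype m]
    (b : Module.Basis m ℂ K) (H : Matrix m m ℂ) (hH : H.IsHermitian) : SesqForm K where
  form x y := star (b.repr x : m → ℂ) ⬝ᵥ H *ᵥ b.repr y
  add_left x y z := by simp [add_dotProduct]
  add_right x y z := by simp [mulVec_add, dotProduct_add]
  smul_left a x y := by simp
  smul_right a x y := by simp [mulVec_smul]
  herm x y := by
    rw [← Complex.star_def, star_dotProduct, star_mulVec, hH.eq, ← dotProduct_mulVec]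

open Matrix in
theorem SesqForm.nondeg_ofMatrix {K m : Type*} [AddCommGroup K] [Module ℂ K] [Fintype m]
    [DecidableEq m] (b : Module.Basis m ℂ K) {H : Matrix m m ℂ} (hH : H.IsHermitian)
    (hdet : H.det ≠ 0) : (SesqForm.ofMatrix b H hH).Nondeg := by
  intro x hx
  have h0 : H *ᵥ (b.repr x : m → ℂ) = 0 := by
    refine dotProduct_eq_zero _ fun w => ?_
    have := (SesqForm.ofMatrix b H hH).herm x (b.equivFun.symm (star w))
    rw [hx, map_zero] at this
    change star (b.equivFun (b.equivFun.symm (star w))) ⬝ᵥ H *ᵥ b.repr x = 0 at this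
    rwa [LinearEquiv.apply_symm_apply, star_star, dotProduct_comm] at this
  exact b.equivFun.map_eq_zero_iff.1 (eq_zero_of_mulVec_eq_zero hdet h0)

/-- Existence of a compatible Krein product. -/
theorem RealStructure.exists_compat [FiniteDimensional ℝ V] {Q : QuadraticForm ℝ V}
    (hdim : Even (Module.finrank ℝ V)) (hQ : QFNondeg Q) (σ : RealStructure Q)
    {K : Type*} [AddCommGroup K] [Module ℂ K] [FiniteDimensional ℂ K]
    (ρ : CCl Q →ₐ[ℂ] Module.End ℂ K) : ∃ h : SesqForm K, h.Nondeg ∧ Compat σ ρ h := by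
  let b := Module.finBasis ℂ K
  let M := (LinearMap.toMatrixAlgEquiv b).toAlgHom.comp ρ
  have hM (a : CCl Q) (x : K) : (b.repr (ρ a x) : _ → ℂ) = (M a).mulVec (b.repr x) :=
    (LinearMap.toMatrix_mulVec_repr b b (ρ a) x).symm
  obtain ⟨H, hH, hdet, hcomp⟩ := σ.exists_isHermitian_matrix hdim hQ M
  refine ⟨SesqForm.ofMatrix b H hH, SesqForm.nondeg_ofMatrix b hH hdet, fun a ψ φ => ?_⟩
  change _ = (SesqForm.ofMatrix b H hH).form ψ (ρ (σ.cross a) φ)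
  simp only [SesqForm.ofMatrix, hM, Matrix.star_mulVec]
  rw [← Matrix.dotProduct_mulVec, Matrix.mulVec_mulVec, Matrix.mulVec_mulVec, hcomp]

/-- The linear map sending `y` to the values of `h(·, y)` on a basis. -/
def SesqForm.coords {K m : Type*} [AddCommGroup K] [Module ℂ K] (b : Module.Basis m ℂ K)
    (h : SesqForm K) : K →ₗ[ℂ] m → ℂ where
  toFun y i := h.form (b i) y
  map_add' y y' := funext fun i => h.add_right (b i) y y'
  map_smul' a y := funext fun i => h.smul_right a (b i) y

theorem SesqForm.form_zero_left {K : Type*} [AddCommGroup K] [Module ℂ K] (h : SesqForm K)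
    (y : K) : h.form 0 y = 0 := by
  simpa using h.smul_left 0 0 y

theorem SesqForm.form_zero_right {K : Type*} [AddCommGroup K] [Module ℂ K] (h : SesqForm K)
    (x : K) : h.form x 0 = 0 := by
  simpa using h.smul_right 0 x 0

/-- Equality of `h₂(·, y)` and `c h₁(·, y)` can be tested on a basis. -/
theorem SesqForm.form_eq_mul_of_basis {K m : Type*} [AddCommGroup K] [Module ℂ K]
    (b : Module.Basis m ℂ K) {h₁ h₂ : SesqForm K} {c : ℂ} {y : K}
    (hy : ∀ i, h₂.form (b i) y = c * h₁.form (b i) y) (x : K) :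
    h₂.form x y = c * h₁.form x y := by
  have hx : x ∈ Submodule.span ℂ (Set.range b) := b.mem_span x
  induction hx using Submodule.span_induction with
  | mem x hx =>
    obtain ⟨i, rfl⟩ := hx
    exact hy i
  | zero => rw [h₁.form_zero_left, h₂.form_zero_left, mul_zero]
  | add x x' _ _ hx hx' => rw [h₁.add_left, h₂.add_left, hx, hx', mul_add]
  | smul a x _ hx => rw [h₁.smul_left, h₂.smul_left, hx, mul_left_comm]

/-- Two hermitian forms, the first one nondegenerate, are proportional at some nonzero vector. -/
theorem SesqForm.exists_eigenvector {K : Type*} [AddCommGroup K] [Module ℂ K]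
    [FiniteDimensional ℂ K] [Nontrivial K] {h₁ : SesqForm K} (hn : h₁.Nondeg) (h₂ : SesqForm K) :
    ∃ (c : ℂ) (y : K), y ≠ 0 ∧ ∀ x, h₂.form x y = c * h₁.form x y := by
  let b := Module.finBasis ℂ K
  have hinj : Function.Injective (h₁.coords b) := by
    refine (injective_iff_map_eq_zero _).2 fun y hy => hn y fun x => ?_
    have : h₁.form x y = 0 * h₁.form x y :=
      SesqForm.form_eq_mul_of_basis b (fun i => (congrFun hy i).trans (zero_mul _).symm) x
    rw [h₁.herm x y, this, zero_mul, map_zero]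
  let L := LinearEquiv.ofInjectiveOfFinrankEq (h₁.coords b) hinj (by simp)
  obtain ⟨c, hc⟩ := Module.End.exists_eigenvalue (L.symm.toLinearMap ∘ₗ h₂.coords b)
  obtain ⟨y, hy⟩ := hc.exists_hasEigenvector
  refine ⟨c, y, hy.2, SesqForm.form_eq_mul_of_basis b fun i => ?_⟩
  have h : h₂.coords b y = c • h₁.coords b y := by
    have := congrArg L hy.apply_eq_smul
    rwa [map_smul, LinearMap.comp_apply, LinearEquiv.coe_coe, L.apply_symm_apply] at this
  exact congrFun h i

/-- Uniqueness of the compatible Krein product for an irreducible representation. -/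
theorem Compat.exists_real_smul {Q : QuadraticForm ℝ V} {σ : RealStructure Q}
    {K : Type*} [AddCommGroup K] [Module ℂ K] [FiniteDimensional ℂ K]
    {ρ : CCl Q →ₐ[ℂ] Module.End ℂ K} (hirr : IsIrreducibleRep ρ) {h₁ h₂ : SesqForm K}
    (hn₁ : h₁.Nondeg) (hc₁ : Compat σ ρ h₁) (hn₂ : h₂.Nondeg) (hc₂ : Compat σ ρ h₂) :
    ∃ r : ℝ, r ≠ 0 ∧ ∀ ψ φ : K, h₂.form ψ φ = (r : ℂ) * h₁.form ψ φ := by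
  obtain ⟨⟨x₀, hx₀⟩, hsimple⟩ := hirr
  have : Nontrivial K := ⟨x₀, 0, hx₀⟩
  obtain ⟨c, y₀, hy₀, hcy⟩ := SesqForm.exists_eigenvector hn₁ h₂
  let P : Submodule ℂ K :=
    { carrier := {y | ∀ x, h₂.form x y = c * h₁.form x y}
      add_mem' := fun hy hy' x => by rw [h₁.add_right, h₂.add_right, hy, hy', mul_add]
      zero_mem' := fun x => by rw [h₁.form_zero_right, h₂.form_zero_right, mul_zero]
      smul_mem' := fun a y hy x => by rw [h₁.smul_right, h₂.smul_right, hy, mul_left_comm] }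
  have hadj {h : SesqForm K} (hc : Compat σ ρ h) (a : CCl Q) (x y : K) :
      h.form x (ρ a y) = h.form (ρ (σ.cross a) x) y := by
    have := hc (σ.cross a) x y
    change _ = h.form x (ρ (σ.cross (σ.cross a)) y) at this
    rw [this, σ.cross_cross]
  have hP : P = ⊤ := by
    refine (hsimple P fun a y hy x => ?_).resolve_left fun h => ?_
    · rw [hadj hc₁, hadj hc₂, hy]
    · have : y₀ ∈ P := hcy
      rw [h] at this
      exact hy₀ ((Submodule.mem_bot ℂ).1 this)
  have hall (x y : K) : h₂.form x y = c * h₁.form x y :=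
    (show y ∈ P from hP ▸ Submodule.mem_top) x
  obtain ⟨y, hy⟩ : ∃ y, h₁.form x₀ y ≠ 0 := by
    by_contra! h
    exact hx₀ (hn₁ x₀ h)
  have hreal : starRingEnd ℂ c = c := by
    have h := h₂.herm x₀ y
    rw [hall, hall, map_mul, ← h₁.herm] at h
    refine (mul_right_cancel₀ ?_ h).symm
    rw [h₁.herm x₀ y]
    simpa using hy
  obtain ⟨r, rfl⟩ := Complex.conj_eq_iff_real.1 hreal
  refine ⟨r, ?_, hall⟩
  rintro rfl
  exact hx₀ (hn₂ x₀ fun y => by simp [hall])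

/-- **Robinson's transfer principle.** For any real structure `σ` and nonzero
representation `ρ` of `ℂl(V)` on a finite-dimensional complex space `K`, there exists a
σ-compatible Krein product on `K`; when `ρ` is irreducible it is unique up to a nonzero
real factor. -/
theorem statement11 [FiniteDimensional ℝ V] (Q : QuadraticForm ℝ V)
    (hdim : Even (Module.finrank ℝ V)) (hQ : QFNondeg Q)
    (σ : RealStructure Q)
    {K : Type*} [AddCommGroup K] [Module ℂ K] [FiniteDimensional ℂ K]
    (ρ : CCl Q →ₐ[ℂ] Module.End ℂ K) (hρ : ∃ a : CCl Q, ρ a ≠ 0) :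
    (∃ h : SesqForm K, h.Nondeg ∧ Compat σ ρ h)
    ∧ (IsIrreducibleRep ρ →
        ∀ h₁ h₂ : SesqForm K, h₁.Nondeg → Compat σ ρ h₁ → h₂.Nondeg → Compat σ ρ h₂ →
          ∃ r : ℝ, r ≠ 0 ∧ ∀ ψ φ : K, h₂.form ψ φ = (r : ℂ) * h₁.form ψ φ) := by
  exact ⟨σ.exists_compat hdim hQ ρ, fun hirr _ _ hn₁ hc₁ hn₂ hc₂ =>
    Compat.exists_real_smul hirr hn₁ hc₁ hn₂ hc₂⟩
end
end
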